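/- Let G be an infinite torsion subgroup of GL_n(ℂ). Then there exists a strictly increasing sequence of finite subgroups G₁ < G₂ < G₃ < ... of G. -/

import Mathlib

open Matrix

instance Int.instIsJacobsonRing : IsJacobsonRing ℤ := by
  refine isJacobsonRing_iff_prime_eq.mpr fun P hP => ?_
  by_cases h : P = ⊥
  · subst h
    refine le_antisymm (fun x hx => ?_) Ideal.le_jacobson
    have hu := Ideal.mem_jacobson_bot.mp hx x
    rcases Int.isUnit_iff.mp hu with h | h <;> rw [Ideal.mem_bot] <;> nlinarith
  · have := hP.isMaximal h
    exact Ideal.jacobson_eq_self_of_isMaximal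

/-- A field that is a quotient of a ring of finite type over `ℤ` is finite. -/
theorem finite_of_surjective_of_finiteType_int {A F : Type*} [CommRing A]
    [Algebra.FiniteType ℤ A] [Field F] (f : A →+* F) (hf : Function.Surjective f) :
    Finite F := by
  have : Algebra.FiniteType ℤ F := .of_surjective f.toIntAlgHom hf
  have hfin : Module.Finite ℤ F := finite_of_finite_type_of_isJacobsonRing ℤ F
  have hint : Algebra.IsIntegral ℤ F := inferInstance
  obtain ⟨p, hp⟩ := CharP.exists F
  have hp0 : p ≠ 0 := by
    rintro rfl
    have : CharZero F := CharP.charP_to_charZero F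
    exact Int.not_isField
      (isField_of_isIntegral_of_isField (R := ℤ) (S := F)
        (FaithfulSMul.algebraMap_injective ℤ F) (Field.toIsField F))
  refine Module.finite_of_fg_torsion F fun x => ⟨⟨(p : ℤ), ?_⟩, ?_⟩
  · simpa using hp0
  · change (p : ℤ) • x = 0
    simp [zsmul_eq_mul]

/-- A nontrivial commutative ring of finite type over `ℤ` has a finite residue field. -/
theorem exists_finite_residue_field (A : Type*) [CommRing A] [Nontrivial A]
    [Algebra.FiniteType ℤ A] : ∃ m : Ideal A, m.IsMaximal ∧ Finite (A ⧸ m) := by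
  obtain ⟨m, hm⟩ := Ideal.exists_maximal A
  let := Ideal.Quotient.field m
  exact ⟨m, hm, finite_of_surjective_of_finiteType_int (Ideal.Quotient.mk m)
    Ideal.Quotient.mk_surjective⟩

/-- A matrix of order dividing `ℓ` over a domain that reduces to the identity in a field in which
`ℓ` is invertible is the identity. -/
theorem Matrix.eq_one_of_pow_eq_one_of_map_eq_one {A F ι : Type*} [CommRing A] [IsDomain A]
    [Field F] [Fintype ι] [DecidableEq ι] (φ : A →+* F) {ℓ : ℕ} (hℓ : (ℓ : F) ≠ 0)
    {M : Matrix ι ι A} (hM : M ^ ℓ = 1) (hφ : φ.mapMatrix M = 1) : M = 1 := by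
  have hmul : (∑ i ∈ Finset.range ℓ, M ^ i) * (M - 1) = 0 := by
    rw [geom_sum_mul, hM, sub_self]
  have hmap : φ.mapMatrix (∑ i ∈ Finset.range ℓ, M ^ i) = (ℓ : Matrix ι ι F) := by
    simp [map_sum, map_pow, hφ, -RingHom.mapMatrix_apply]
  have hdet : (∑ i ∈ Finset.range ℓ, M ^ i).det ≠ 0 := by
    intro h
    have := φ.map_det (∑ i ∈ Finset.range ℓ, M ^ i)
    rw [h, map_zero, hmap, ← Matrix.diagonal_natCast, Matrix.det_diagonal,
      Finset.prod_const] at this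
    exact pow_ne_zero _ hℓ this.symm
  have h := congrArg ((∑ i ∈ Finset.range ℓ, M ^ i).adjugate * ·) hmul
  simp only [← mul_assoc, Matrix.adjugate_mul, mul_zero, smul_mul_assoc, one_mul] at h
  exact sub_eq_zero.mp ((smul_eq_zero.mp h).resolve_left hdet)

/-- Over a domain with homomorphisms to two finite fields of distinct characteristics, torsion
linear groups are finite. -/
theorem Matrix.GeneralLinearGroup.finite_of_isOfFinOrder {A F₁ F₂ ι : Type*} [CommRing A]
    [IsDomain A] [Field F₁] [Finite F₁] [Field F₂] [Finite F₂] [Fintype ι] [DecidableEq ι]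
    (φ₁ : A →+* F₁) (φ₂ : A →+* F₂)
    (hchar : ∀ ℓ : ℕ, ℓ.Prime → (ℓ : F₁) ≠ 0 ∨ (ℓ : F₂) ≠ 0)
    (H : Subgroup (GL ι A)) (hH : ∀ g ∈ H, IsOfFinOrder g) : Finite H := by
  let ψ : GL ι A →* GL ι F₁ × GL ι F₂ :=
    (GeneralLinearGroup.map φ₁).prod (GeneralLinearGroup.map φ₂)
  refine Finite.of_injective (ψ.comp H.subtype) ((injective_iff_map_eq_one _).mpr ?_)
  rintro ⟨g, hg⟩ hψ
  change ψ g = 1 at hψ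
  by_contra hne
  have hg1 : orderOf g ≠ 1 := fun h => hne (Subtype.ext (orderOf_eq_one_iff.mp h))
  obtain ⟨ℓ, hℓ, hdvd⟩ := Nat.exists_prime_and_dvd hg1
  have hpos := (hH g hg).orderOf_pos
  obtain ⟨k, hk⟩ := hdvd
  have hpow : (g ^ k) ^ ℓ = 1 := by
    rw [← pow_mul, mul_comm, ← hk, pow_orderOf_eq_one]
  have hψk : ψ (g ^ k) = 1 := by rw [map_pow, hψ, one_pow]
  have hM : (g ^ k : GL ι A).val ^ ℓ = 1 := by
    rw [← Units.val_pow_eq_pow_val, hpow, Units.val_one]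
  have hk1 : g ^ k = 1 := by
    apply Units.ext
    rcases hchar ℓ hℓ with h | h
    · exact Matrix.eq_one_of_pow_eq_one_of_map_eq_one φ₁ h hM
        (congrArg Units.val (congrArg Prod.fst hψk))
    · exact Matrix.eq_one_of_pow_eq_one_of_map_eq_one φ₂ h hM
        (congrArg Units.val (congrArg Prod.snd hψk))
  have hkpos : 0 < k := Nat.pos_of_ne_zero (by rintro rfl; simp [hk] at hpos)
  have hle := Nat.le_of_dvd hkpos (orderOf_dvd_of_pow_eq_one hk1)
  nlinarith [hℓ.two_le]

/-- A finitely generated subring of a field of characteristic zero has homomorphisms to two finite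
fields of distinct characteristics. -/
theorem exists_ringHom_finite_fields.{u} {K : Type u} [Field K] [CharZero K] {S : Set K}
    (hS : S.Finite) : ∃ (F₁ F₂ : Type u) (_ : Field F₁) (_ : Field F₂) (_ : Finite F₁)
      (_ : Finite F₂) (_ : Algebra.adjoin ℤ S →+* F₁) (_ : Algebra.adjoin ℤ S →+* F₂),
      ∀ ℓ : ℕ, ℓ.Prime → (ℓ : F₁) ≠ 0 ∨ (ℓ : F₂) ≠ 0 := by
  have hft : ∀ T : Set K, T.Finite → Algebra.FiniteType ℤ (Algebra.adjoin ℤ T) := fun T hT =>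
    (Subalgebra.fg_iff_finiteType _).mp ⟨hT.toFinset, by simp⟩
  have := hft S hS
  obtain ⟨m, hm, hmfin⟩ := exists_finite_residue_field (Algebra.adjoin ℤ S)
  let := Ideal.Quotient.field m
  obtain ⟨p, hp⟩ := CharP.exists (Algebra.adjoin ℤ S ⧸ m)
  have hp0 : p ≠ 0 := CharP.char_ne_zero_of_finite (Algebra.adjoin ℤ S ⧸ m) p
  have := hft (insert (p : K)⁻¹ S) (hS.insert _)
  obtain ⟨m', hm', hmfin'⟩ := exists_finite_residue_field (Algebra.adjoin ℤ (insert (p : K)⁻¹ S))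
  let := Ideal.Quotient.field m'
  let inc := Subalgebra.inclusion (Algebra.adjoin_mono (R := ℤ) (Set.subset_insert (p : K)⁻¹ S))
  refine ⟨_, _, inferInstance, inferInstance, hmfin, hmfin', Ideal.Quotient.mk m,
    (Ideal.Quotient.mk m').comp inc.toRingHom, fun ℓ hℓ => ?_⟩
  by_contra! h
  have hpℓ : p = ℓ :=
    ((Nat.dvd_prime hℓ).mp ((CharP.cast_eq_zero_iff _ p ℓ).mp h.1)).resolve_left
      (CharP.char_ne_one (Algebra.adjoin ℤ S ⧸ m) p)
  subst hpℓ
  let u : Algebra.adjoin ℤ (insert (p : K)⁻¹ S) :=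
    ⟨(p : K)⁻¹, Algebra.subset_adjoin (Set.mem_insert _ _)⟩
  have hu : (p : Algebra.adjoin ℤ (insert (p : K)⁻¹ S)) * u = 1 :=
    Subtype.ext (by simp [u, hp0])
  have := congrArg (Ideal.Quotient.mk m') hu
  rw [map_mul, map_natCast, h.2, zero_mul, map_one] at this
  exact zero_ne_one this

/-- An invertible matrix is defined over a subring containing its entries and those of its
inverse. -/
theorem Matrix.GeneralLinearGroup.mem_range_map_subtype {K ι : Type*} [CommRing K] [Fintype ι]
    [DecidableEq ι] (A : Subalgebra ℤ K) (g : GL ι K) (h : ∀ i j, g i j ∈ A)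
    (h' : ∀ i j, g⁻¹ i j ∈ A) :
    g ∈ (GeneralLinearGroup.map (n := ι) (A.val : A →+* K)).range := by
  have hinj : Function.Injective ((A.val : A →+* K).mapMatrix (m := ι)) :=
    Matrix.map_injective Subtype.val_injective
  refine ⟨⟨of fun i j => ⟨g i j, h i j⟩, of fun i j => ⟨g⁻¹ i j, h' i j⟩, hinj ?_, hinj ?_⟩, ?_⟩
  · rw [map_mul, map_one]; exact g.mul_inv
  · rw [map_mul, map_one]; exact g.inv_mul
  · ext i j; rfl

/-- **Schur's theorem**: a finitely generated torsion linear group over a field of characteristic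
zero is finite. -/
theorem Matrix.GeneralLinearGroup.finite_of_fg_of_isOfFinOrder {K ι : Type*} [Field K]
    [CharZero K] [Fintype ι] [DecidableEq ι] {H : Subgroup (GL ι K)} (hfg : H.FG)
    (hH : ∀ g ∈ H, IsOfFinOrder g) : Finite H := by
  obtain ⟨T, rfl⟩ := hfg
  let S : Set K := ⋃ g ∈ T, ⋃ i, ⋃ j, {g i j, g⁻¹ i j}
  have hS : S.Finite := T.finite_toSet.biUnion fun g _ =>
    Set.finite_iUnion fun i => Set.finite_iUnion fun j => Set.toFinite _
  have hmem : ∀ g ∈ T, ∀ i j, g i j ∈ S ∧ g⁻¹ i j ∈ S := fun g hg i j => by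
    simp only [S, Set.mem_iUnion]
    exact ⟨⟨g, hg, i, j, .inl rfl⟩, ⟨g, hg, i, j, .inr rfl⟩⟩
  obtain ⟨F₁, F₂, _, _, _, _, φ₁, φ₂, hchar⟩ := exists_ringHom_finite_fields hS
  let f : GL ι (Algebra.adjoin ℤ S) →* GL ι K :=
    GeneralLinearGroup.map ((Algebra.adjoin ℤ S).val : Algebra.adjoin ℤ S →+* K)
  have hf : Function.Injective f := Units.map_injective (Matrix.map_injective Subtype.val_injective)
  have hle : Subgroup.closure (T : Set (GL ι K)) ≤ f.range := by
    rw [Subgroup.closure_le]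
    exact fun g hg => mem_range_map_subtype _ g
      (fun i j => Algebra.subset_adjoin (hmem g hg i j).1)
      (fun i j => Algebra.subset_adjoin (hmem g hg i j).2)
  have : Finite ((Subgroup.closure (T : Set (GL ι K))).comap f) :=
    finite_of_isOfFinOrder φ₁ φ₂ hchar _ fun g hg =>
      (hf.isOfFinOrder_iff (f := f)).mp (hH _ hg)
  rw [← Subgroup.map_comap_eq_self hle]
  exact Set.Finite.image f (Set.toFinite _)

/-- An infinite torsion subgroup of `GL_n(ℂ)` contains a strictly increasing sequence of
finite subgroups. -/
theorem infinite_torsion_linear_group_strict_chain_of_finite_subgroups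
    (n : ℕ) (G : Subgroup (GL (Fin n) ℂ)) (hinf : Infinite G)
    (htor : ∀ g ∈ G, IsOfFinOrder g) :
    ∃ f : ℕ → Subgroup (GL (Fin n) ℂ),
      StrictMono f ∧ (∀ k, f k ≤ G) ∧ (∀ k, Finite (f k)) := by
  let P := {H : Subgroup (GL (Fin n) ℂ) // H ≤ G ∧ Finite H}
  have : Nonempty P := ⟨⟨⊥, bot_le, inferInstance⟩⟩
  have : NoMaxOrder P := by
    refine ⟨fun ⟨H, hle, hfin⟩ => ?_⟩
    obtain ⟨g, hgG, hgH⟩ : ∃ g ∈ G, g ∉ H := by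
      by_contra! h
      exact hinf.not_finite (le_antisymm hle h ▸ hfin)
    have hsup : H ⊔ Subgroup.zpowers g ≤ G := sup_le hle (Subgroup.zpowers_le.mpr hgG)
    have hfg : (H ⊔ Subgroup.zpowers g).FG :=
      ((Group.fg_iff_subgroup_fg H).mp inferInstance).sup ⟨{g}, by simp [Subgroup.zpowers_eq_closure]⟩
    refine ⟨⟨H ⊔ Subgroup.zpowers g, hsup,
      GeneralLinearGroup.finite_of_fg_of_isOfFinOrder hfg fun x hx => htor x (hsup hx)⟩, ?_⟩
    change H < H ⊔ Subgroup.zpowers g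
    exact left_lt_sup.mpr fun h => hgH (h (Subgroup.mem_zpowers g))
  obtain ⟨f, hf⟩ := Nat.exists_strictMono P
  exact ⟨fun k => (f k).1, fun _ _ h => hf h, fun k => (f k).2.1, fun k => (f k).2.2⟩
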